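/- (The maximal squared norm 𝒮² of the second fundamental form of the type-II Lawson–Osserman sphere.) One has ‖B^{4n+4}‖² = (4n+3)(4n+5)/(8(n+1)) and ‖B^{8n+3+α}‖² = (4n+3)(4n+5)/(4(n+1)(n+2)) for 2 ≤ α ≤ n. Moreover, for every real family (λ_ν)_{ν ∈ J} with Σ_{ν ∈ J} λ_ν² = 1, the squared Frobenius norm of Σ_{ν ∈ J} λ_ν B^ν satisfies ‖ Σ_ν λ_ν B^ν ‖² ≤ (4n+3)(4n+5)/(8(n+1)), with equality if and only if λ_{4n+4} = ±1 and all other λ_ν = 0; and (4n+3)(4n+5)/(8(n+1)) < 2(n+1), i.e., this maximum is strictly less than half the dimension 4n+4 of the cone C F'. -/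

import Mathlib

open scoped BigOperators

/-- Pairs `k < l` of indices in `Fin m`. -/
abbrev SpherePairs (m : ℕ) := {p : Fin m × Fin m // p.1 < p.2}

/-- The constant `c_{n,α}` (with `α` given 1-based). -/
noncomputable def LOc (n α : ℕ) : ℝ :=
  Real.sqrt (((n : ℝ) + 1) * ((n : ℝ) + 1 - α) / ((n : ℝ) * ((n : ℝ) + 2 - α)))

/-- The constant `d_n`. -/
noncomputable def LOd (n : ℕ) : ℝ := Real.sqrt (2 * ((n : ℝ) + 1) / n)

/-- The constant `ã_n`. -/
noncomputable def LOat (n : ℕ) : ℝ :=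
  Real.sqrt (6 * ((n : ℝ) + 1) / (((n : ℝ) + 2) * (4 * n + 3)))

/-- The constant `b̃_n`. -/
noncomputable def LObt (n : ℕ) : ℝ :=
  Real.sqrt ((n : ℝ) * (4 * n + 5) / (((n : ℝ) + 2) * (4 * n + 3)))

/-- `q̃ = ã_n² + b̃_n² d_n²`. -/
noncomputable def LOqt (n : ℕ) : ℝ := LOat n ^ 2 + LObt n ^ 2 * LOd n ^ 2

/-- `ṽ = b̃_n d_n / q̃`. -/
noncomputable def LOvt (n : ℕ) : ℝ := LObt n * LOd n / LOqt n

/-- The symmetric matrix with entry `x` at positions `(i,j)` and `(j,i)` and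
zeros elsewhere. -/
def symEntry {m : ℕ} (i j : Fin m) (x : ℝ) : Matrix (Fin m) (Fin m) ℝ :=
  fun a b => if (a = i ∧ b = j) ∨ (a = j ∧ b = i) then x else 0

/-- The matrix `B^{4n+4}`. -/
noncomputable def MatII0 (n : ℕ) : Matrix (Fin (4 * n + 3)) (Fin (4 * n + 3)) ℝ :=
  Matrix.diagonal fun a =>
    if a.val = 0 ∨ a.val = 1 ∨ a.val = 2 * n + 2 then LObt n / LOat n
    else -(((n : ℝ) + 2) * LOat n * LObt n) / ((n : ℝ) * LOqt n)

/-- The matrix `B^{4n+1+2k}`, for `κ : Fin n` representing `k = κ + 2`. -/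
noncomputable def MatII1 (n : ℕ) (κ : Fin n) :
    Matrix (Fin (4 * n + 3)) (Fin (4 * n + 3)) ℝ :=
  symEntry ⟨0, by omega⟩ ⟨2 * n + 2 * κ.val + 3, by have := κ.isLt; omega⟩ (LOvt n) +
    symEntry ⟨1, by omega⟩ ⟨2 * κ.val + 3, by have := κ.isLt; omega⟩ (LOvt n) +
    symEntry ⟨2 * n + 2, by omega⟩ ⟨2 * n + 2 * κ.val + 4, by have := κ.isLt; omega⟩ (LOvt n)

/-- The matrix `B^{4n+2+2k}`. -/
noncomputable def MatII2 (n : ℕ) (κ : Fin n) :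
    Matrix (Fin (4 * n + 3)) (Fin (4 * n + 3)) ℝ :=
  symEntry ⟨0, by omega⟩ ⟨2 * n + 2 * κ.val + 4, by have := κ.isLt; omega⟩ (LOvt n) +
    symEntry ⟨1, by omega⟩ ⟨2 * κ.val + 2, by have := κ.isLt; omega⟩ (-(LOvt n)) +
    symEntry ⟨2 * n + 2, by omega⟩ ⟨2 * n + 2 * κ.val + 3, by have := κ.isLt; omega⟩ (-(LOvt n))

/-- The matrix `B^{6n+1+2k}`. -/
noncomputable def MatII3 (n : ℕ) (κ : Fin n) :
    Matrix (Fin (4 * n + 3)) (Fin (4 * n + 3)) ℝ :=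
  symEntry ⟨0, by omega⟩ ⟨2 * κ.val + 2, by have := κ.isLt; omega⟩ (-(LOvt n)) +
    symEntry ⟨1, by omega⟩ ⟨2 * n + 2 * κ.val + 4, by have := κ.isLt; omega⟩ (-(LOvt n)) +
    symEntry ⟨2 * n + 2, by omega⟩ ⟨2 * κ.val + 3, by have := κ.isLt; omega⟩ (LOvt n)

/-- The matrix `B^{6n+2+2k}`. -/
noncomputable def MatII4 (n : ℕ) (κ : Fin n) :
    Matrix (Fin (4 * n + 3)) (Fin (4 * n + 3)) ℝ :=
  symEntry ⟨0, by omega⟩ ⟨2 * κ.val + 3, by have := κ.isLt; omega⟩ (-(LOvt n)) +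
    symEntry ⟨1, by omega⟩ ⟨2 * n + 2 * κ.val + 3, by have := κ.isLt; omega⟩ (LOvt n) +
    symEntry ⟨2 * n + 2, by omega⟩ ⟨2 * κ.val + 2, by have := κ.isLt; omega⟩ (-(LOvt n))

/-- The matrix `B^{8n+3+α}`, for `β : Fin (n-1)` representing `α = β + 2`. -/
noncomputable def MatIID (n : ℕ) (β : Fin (n - 1)) :
    Matrix (Fin (4 * n + 3)) (Fin (4 * n + 3)) ℝ :=
  Matrix.diagonal fun a =>
    if a.val = 2 * β.val + 2 ∨ a.val = 2 * β.val + 3 ∨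
        a.val = 2 * n + 2 * β.val + 3 ∨ a.val = 2 * n + 2 * β.val + 4 then
      2 * LObt n * LOc n (β.val + 2) / LOqt n
    else if (2 * β.val + 4 ≤ a.val ∧ a.val ≤ 2 * n + 1) ∨ 2 * n + 2 * β.val + 5 ≤ a.val then
      -(2 * LObt n * LOc n (β.val + 2)) / (((n : ℝ) - 1 - β.val) * LOqt n)
    else 0

/-- The matrix `B^{(k,l)}`, for a pair `κ < λ` in `Fin n` representing
`k = κ + 2 < l = λ + 2`. -/
noncomputable def MatIIE (n : ℕ) (p : SpherePairs n) :
    Matrix (Fin (4 * n + 3)) (Fin (4 * n + 3)) ℝ :=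
  symEntry ⟨2 * p.1.1.val + 2, by have := p.1.1.isLt; omega⟩
      ⟨2 * p.1.2.val + 2, by have := p.1.2.isLt; omega⟩ (LOvt n) +
    symEntry ⟨2 * p.1.1.val + 3, by have := p.1.1.isLt; omega⟩
      ⟨2 * p.1.2.val + 3, by have := p.1.2.isLt; omega⟩ (LOvt n) +
    symEntry ⟨2 * n + 2 * p.1.1.val + 3, by have := p.1.1.isLt; omega⟩
      ⟨2 * n + 2 * p.1.2.val + 3, by have := p.1.2.isLt; omega⟩ (LOvt n) +
    symEntry ⟨2 * n + 2 * p.1.1.val + 4, by have := p.1.1.isLt; omega⟩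
      ⟨2 * n + 2 * p.1.2.val + 4, by have := p.1.2.isLt; omega⟩ (LOvt n)

/-- The matrix `B^{(k̄,l̄)}`. -/
noncomputable def MatIIF (n : ℕ) (p : SpherePairs n) :
    Matrix (Fin (4 * n + 3)) (Fin (4 * n + 3)) ℝ :=
  symEntry ⟨2 * p.1.1.val + 2, by have := p.1.1.isLt; omega⟩
      ⟨2 * n + 2 * p.1.2.val + 3, by have := p.1.2.isLt; omega⟩ (LOvt n) +
    symEntry ⟨2 * p.1.2.val + 3, by have := p.1.2.isLt; omega⟩
      ⟨2 * n + 2 * p.1.1.val + 4, by have := p.1.1.isLt; omega⟩ (LOvt n) +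
    symEntry ⟨2 * p.1.1.val + 3, by have := p.1.1.isLt; omega⟩
      ⟨2 * n + 2 * p.1.2.val + 4, by have := p.1.2.isLt; omega⟩ (-(LOvt n)) +
    symEntry ⟨2 * p.1.2.val + 2, by have := p.1.2.isLt; omega⟩
      ⟨2 * n + 2 * p.1.1.val + 3, by have := p.1.1.isLt; omega⟩ (-(LOvt n))

/-- The matrix `B^{[k,l]}`. -/
noncomputable def MatIIG (n : ℕ) (p : SpherePairs n) :
    Matrix (Fin (4 * n + 3)) (Fin (4 * n + 3)) ℝ :=
  symEntry ⟨2 * p.1.1.val + 2, by have := p.1.1.isLt; omega⟩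
      ⟨2 * p.1.2.val + 3, by have := p.1.2.isLt; omega⟩ (LOvt n) +
    symEntry ⟨2 * n + 2 * p.1.1.val + 3, by have := p.1.1.isLt; omega⟩
      ⟨2 * n + 2 * p.1.2.val + 4, by have := p.1.2.isLt; omega⟩ (LOvt n) +
    symEntry ⟨2 * p.1.1.val + 3, by have := p.1.1.isLt; omega⟩
      ⟨2 * p.1.2.val + 2, by have := p.1.2.isLt; omega⟩ (-(LOvt n)) +
    symEntry ⟨2 * n + 2 * p.1.1.val + 4, by have := p.1.1.isLt; omega⟩
      ⟨2 * n + 2 * p.1.2.val + 3, by have := p.1.2.isLt; omega⟩ (-(LOvt n))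

/-- The matrix `B^{[k̄,l̄]}`. -/
noncomputable def MatIIH (n : ℕ) (p : SpherePairs n) :
    Matrix (Fin (4 * n + 3)) (Fin (4 * n + 3)) ℝ :=
  symEntry ⟨2 * p.1.1.val + 2, by have := p.1.1.isLt; omega⟩
      ⟨2 * n + 2 * p.1.2.val + 4, by have := p.1.2.isLt; omega⟩ (LOvt n) +
    symEntry ⟨2 * p.1.1.val + 3, by have := p.1.1.isLt; omega⟩
      ⟨2 * n + 2 * p.1.2.val + 3, by have := p.1.2.isLt; omega⟩ (LOvt n) +
    symEntry ⟨2 * p.1.2.val + 2, by have := p.1.2.isLt; omega⟩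
      ⟨2 * n + 2 * p.1.1.val + 4, by have := p.1.1.isLt; omega⟩ (-(LOvt n)) +
    symEntry ⟨2 * p.1.2.val + 3, by have := p.1.2.isLt; omega⟩
      ⟨2 * n + 2 * p.1.1.val + 3, by have := p.1.1.isLt; omega⟩ (-(LOvt n))

/-- Index type for the `n(2n+3)` type-II second-fundamental-form matrices. -/
abbrev TypeIIIdx (n : ℕ) :=
  (Unit ⊕ Fin (n - 1)) ⊕
    (Fin n ⊕ Fin n ⊕ Fin n ⊕ Fin n ⊕
      SpherePairs n ⊕ SpherePairs n ⊕ SpherePairs n ⊕ SpherePairs n)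

/-- The full family of type-II second-fundamental-form matrices. -/
noncomputable def Bmat (n : ℕ) : TypeIIIdx n → Matrix (Fin (4 * n + 3)) (Fin (4 * n + 3)) ℝ
  | Sum.inl (Sum.inl _) => MatII0 n
  | Sum.inl (Sum.inr β) => MatIID n β
  | Sum.inr (Sum.inl κ) => MatII1 n κ
  | Sum.inr (Sum.inr (Sum.inl κ)) => MatII2 n κ
  | Sum.inr (Sum.inr (Sum.inr (Sum.inl κ))) => MatII3 n κ
  | Sum.inr (Sum.inr (Sum.inr (Sum.inr (Sum.inl κ)))) => MatII4 n κ
  | Sum.inr (Sum.inr (Sum.inr (Sum.inr (Sum.inr (Sum.inl p))))) => MatIIE n p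
  | Sum.inr (Sum.inr (Sum.inr (Sum.inr (Sum.inr (Sum.inr (Sum.inl p)))))) => MatIIF n p
  | Sum.inr (Sum.inr (Sum.inr (Sum.inr (Sum.inr (Sum.inr (Sum.inr (Sum.inl p))))))) => MatIIG n p
  | Sum.inr (Sum.inr (Sum.inr (Sum.inr (Sum.inr (Sum.inr (Sum.inr (Sum.inr p))))))) => MatIIH n p

/-- The Frobenius inner product of two real square matrices. -/
def frobeniusInner {m : ℕ} (M N : Matrix (Fin m) (Fin m) ℝ) : ℝ :=
  ∑ a, ∑ b, M a b * N a b

lemma frobeniusInner_comm {m : ℕ} (M N : Matrix (Fin m) (Fin m) ℝ) :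
    frobeniusInner M N = frobeniusInner N M := by
  simp only [frobeniusInner, mul_comm]

lemma frobeniusInner_add_left {m : ℕ} (M M' N : Matrix (Fin m) (Fin m) ℝ) :
    frobeniusInner (M + M') N = frobeniusInner M N + frobeniusInner M' N := by
  simp only [frobeniusInner, Matrix.add_apply, add_mul, Finset.sum_add_distrib]

lemma frobeniusInner_add_right {m : ℕ} (M N N' : Matrix (Fin m) (Fin m) ℝ) :
    frobeniusInner M (N + N') = frobeniusInner M N + frobeniusInner M N' := by
  simp only [frobeniusInner, Matrix.add_apply, mul_add, Finset.sum_add_distrib]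

lemma frobeniusInner_self {m : ℕ} (M : Matrix (Fin m) (Fin m) ℝ) :
    frobeniusInner M M = ∑ a, ∑ b, M a b ^ 2 := by
  simp only [frobeniusInner, sq]

lemma frobeniusInner_diagonal {m : ℕ} (d e : Fin m → ℝ) :
    frobeniusInner (Matrix.diagonal d) (Matrix.diagonal e) = ∑ a, d a * e a := by
  refine Finset.sum_congr rfl fun a _ => ?_
  rw [Finset.sum_eq_single a (fun b _ hb => by simp [Matrix.diagonal_apply_ne' _ hb]) (by simp)]
  simp

lemma symEntry_eq_single_add_single {m : ℕ} {i j : Fin m} (h : i.val ≠ j.val) (x : ℝ) :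
    symEntry i j x = Matrix.single i j x + Matrix.single j i x := by
  have h' : i ≠ j := fun e => h (congrArg Fin.val e)
  ext a b
  simp only [symEntry, Matrix.add_apply, Matrix.single_apply]
  grind

lemma frobeniusInner_single {m : ℕ} (i j : Fin m) (x : ℝ) (N : Matrix (Fin m) (Fin m) ℝ) :
    frobeniusInner (Matrix.single i j x) N = x * N i j := by
  unfold frobeniusInner
  rw [Finset.sum_eq_single i _ (by simp), Finset.sum_eq_single j _ (by simp)]
  · simp
  · intro b _ hb
    simp [hb.symm]
  · intro a _ ha
    simp [ha.symm]

lemma frobeniusInner_symEntry {m : ℕ} {i j : Fin m} (h : i.val ≠ j.val) (x : ℝ)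
    (N : Matrix (Fin m) (Fin m) ℝ) :
    frobeniusInner (symEntry i j x) N = x * (N i j + N j i) := by
  rw [symEntry_eq_single_add_single h, frobeniusInner_add_left, frobeniusInner_single,
    frobeniusInner_single, mul_add]

lemma frobeniusInner_diagonal_symEntry {m : ℕ} (d : Fin m → ℝ) {i j : Fin m}
    (h : i.val ≠ j.val) (x : ℝ) :
    frobeniusInner (Matrix.diagonal d) (symEntry i j x) = 0 := by
  have h' : i ≠ j := fun e => h (congrArg Fin.val e)
  rw [frobeniusInner_comm, frobeniusInner_symEntry h, Matrix.diagonal_apply_ne _ h',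
    Matrix.diagonal_apply_ne' _ h', add_zero, mul_zero]

lemma frobeniusInner_symEntry_self {m : ℕ} {i j : Fin m} (h : i.val ≠ j.val) (x : ℝ) :
    frobeniusInner (symEntry i j x) (symEntry i j x) = 2 * x ^ 2 := by
  rw [frobeniusInner_symEntry h]
  simp [symEntry]
  ring

lemma frobeniusInner_symEntry_of_disjoint {m : ℕ} {i j k l : Fin m} (h : i.val ≠ j.val)
    (h₁ : ¬(i.val = k.val ∧ j.val = l.val)) (h₂ : ¬(i.val = l.val ∧ j.val = k.val)) (x y : ℝ) :
    frobeniusInner (symEntry i j x) (symEntry k l y) = 0 := by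
  have e₁ : ¬(i = k ∧ j = l) := by simpa only [Fin.ext_iff] using h₁
  have e₂ : ¬(i = l ∧ j = k) := by simpa only [Fin.ext_iff] using h₂
  rw [frobeniusInner_symEntry h]
  simp only [symEntry]
  rw [if_neg (by tauto), if_neg (by tauto)]
  simp

lemma sum_range_two_mul (m : ℕ) (g : ℕ → ℝ) :
    ∑ i ∈ Finset.range (2 * m), g i = ∑ i ∈ Finset.range m, (g (2 * i) + g (2 * i + 1)) := by
  induction m with
  | zero => simp
  | succ m ih => rw [mul_add, Finset.sum_range_succ _ m, ← ih, mul_one, Finset.sum_range_succ,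
      Finset.sum_range_succ, add_assoc]

/-- Splitting of a sum over the indices of the matrices into the three exceptional positions
and the blocks of four. -/
lemma sum_fin_eq_blocks (n : ℕ) (g : ℕ → ℝ) :
    ∑ a : Fin (4 * n + 3), g a.val = g 0 + g 1 + g (2 * n + 2) +
      ∑ κ ∈ Finset.range n, (g (2 * κ + 2) + g (2 * κ + 3) + g (2 * n + 2 * κ + 3) +
        g (2 * n + 2 * κ + 4)) := by
  rw [Finset.sum_range g |>.symm, show 4 * n + 3 = (2 * n + 3) + 2 * n by ring,
    Finset.sum_range_add, Finset.sum_range_succ, show 2 * n + 2 = 2 + 2 * n by ring,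
    Finset.sum_range_add, sum_range_two_mul n (fun x => g (2 + x)),
    sum_range_two_mul n (fun x => g (2 * n + 3 + x))]
  simp only [Finset.sum_add_distrib, Finset.sum_range_succ, Finset.sum_range_zero]
  ring_nf

/-- The diagonal sequence vanishing before the block `b`, equal to `p` on it and to `q` on the
later blocks. -/
def stepSeq (n b : ℕ) (p q : ℝ) (a : ℕ) : ℝ :=
  if a = 2 * b + 2 ∨ a = 2 * b + 3 ∨ a = 2 * n + 2 * b + 3 ∨ a = 2 * n + 2 * b + 4 then p
  else if (2 * b + 4 ≤ a ∧ a ≤ 2 * n + 1) ∨ 2 * n + 2 * b + 5 ≤ a then q else 0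

lemma sum_range_step {n b : ℕ} (hb : b < n) (P Q : ℝ) :
    ∑ κ ∈ Finset.range n, (if κ = b then P else if b < κ then Q else 0) =
      P + ((n : ℝ) - 1 - b) * Q := by
  induction n, hb using Nat.le_induction with
  | base =>
    rw [Finset.sum_range_succ, Finset.sum_eq_zero]
    · simp
    · intro κ hκ
      have := Finset.mem_range.mp hκ
      rw [if_neg (by omega), if_neg (by omega)]
  | succ m hm ih =>
    rw [Finset.sum_range_succ, ih, if_neg (by omega), if_pos (by omega)]
    push_cast
    ring

lemma sum_mul_stepSeq {n b : ℕ} (hb : b < n) (g : ℕ → ℝ) {p q P Q : ℝ}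
    (hP : ∀ a, a = 2 * b + 2 ∨ a = 2 * b + 3 ∨ a = 2 * n + 2 * b + 3 ∨ a = 2 * n + 2 * b + 4 →
      g a = P)
    (hQ : ∀ a, (2 * b + 4 ≤ a ∧ a ≤ 2 * n + 1) ∨ 2 * n + 2 * b + 5 ≤ a → g a = Q) :
    ∑ a : Fin (4 * n + 3), g a.val * stepSeq n b p q a.val =
      4 * (P * p + ((n : ℝ) - 1 - b) * (Q * q)) := by
  have on_block : ∀ a, a = 2 * b + 2 ∨ a = 2 * b + 3 ∨ a = 2 * n + 2 * b + 3 ∨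
      a = 2 * n + 2 * b + 4 → g a * stepSeq n b p q a = P * p := fun a ha => by
    rw [hP a ha, stepSeq, if_pos ha]
  have after : ∀ a, (2 * b + 4 ≤ a ∧ a ≤ 2 * n + 1) ∨ 2 * n + 2 * b + 5 ≤ a →
      g a * stepSeq n b p q a = Q * q := fun a ha => by
    rw [hQ a ha, stepSeq, if_neg (by omega), if_pos ha]
  have elsewhere : ∀ a, (a < 2 * b + 2 ∨ (2 * n + 2 ≤ a ∧ a < 2 * n + 2 * b + 3)) →
      g a * stepSeq n b p q a = 0 := fun a ha => by
    rw [stepSeq, if_neg (by omega), if_neg (by omega), mul_zero]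
  rw [sum_fin_eq_blocks n fun a => g a * stepSeq n b p q a, elsewhere _ (by omega),
    elsewhere _ (by omega), elsewhere _ (by omega), add_zero, add_zero, zero_add,
    Finset.sum_congr rfl (g := fun κ => if κ = b then 4 * (P * p) else
      if b < κ then 4 * (Q * q) else 0), sum_range_step hb]
  · ring
  · intro κ hκ
    have hκ' := Finset.mem_range.mp hκ
    rcases lt_trichotomy κ b with h | h | h
    · rw [if_neg (by omega), if_neg (by omega), elsewhere _ (by omega), elsewhere _ (by omega),
        elsewhere _ (by omega), elsewhere _ (by omega)]
      ring
    · rw [if_pos h, on_block _ (by omega), on_block _ (by omega), on_block _ (by omega),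
        on_block _ (by omega)]
      ring
    · rw [if_neg (by omega), if_pos h, after _ (by omega), after _ (by omega),
        after _ (by omega), after _ (by omega)]
      ring

section Constants

variable {n : ℕ}

lemma LOat_sq (n : ℕ) : LOat n ^ 2 = 6 * ((n : ℝ) + 1) / (((n : ℝ) + 2) * (4 * n + 3)) :=
  Real.sq_sqrt (by positivity)

lemma LObt_sq (n : ℕ) :
    LObt n ^ 2 = (n : ℝ) * (4 * n + 5) / (((n : ℝ) + 2) * (4 * n + 3)) :=
  Real.sq_sqrt (by positivity)

lemma LOd_sq (n : ℕ) : LOd n ^ 2 = 2 * ((n : ℝ) + 1) / n :=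
  Real.sq_sqrt (by positivity)

lemma LOc_sq {b : ℕ} (hb : b < n - 1) :
    LOc n (b + 2) ^ 2 = ((n : ℝ) + 1) * ((n : ℝ) - 1 - b) / ((n : ℝ) * ((n : ℝ) - b)) := by
  have h : (b : ℝ) + 2 ≤ n := by exact_mod_cast (by omega : b + 2 ≤ n)
  have e₁ : (n : ℝ) + 1 - ((b + 2 : ℕ) : ℝ) = n - 1 - b := by push_cast; ring
  have e₂ : (n : ℝ) + 2 - ((b + 2 : ℕ) : ℝ) = n - b := by push_cast; ring
  rw [LOc, e₁, e₂]
  exact Real.sq_sqrt (div_nonneg (mul_nonneg (by positivity) (by linarith))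
    (mul_nonneg (by positivity) (by linarith)))

lemma LOqt_eq (hn : 1 ≤ n) : LOqt n = 8 * ((n : ℝ) + 1) / (4 * n + 3) := by
  have h : (n : ℝ) ≠ 0 := by positivity
  rw [LOqt, LOat_sq, LObt_sq, LOd_sq]
  field_simp
  ring

lemma LOvt_sq (hn : 1 ≤ n) :
    LOvt n ^ 2 = (4 * (n : ℝ) + 3) * (4 * n + 5) / (32 * ((n : ℝ) + 1) * ((n : ℝ) + 2)) := by
  have h : (n : ℝ) ≠ 0 := by positivity
  rw [LOvt, div_pow, mul_pow, LObt_sq, LOd_sq, LOqt_eq hn]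
  field_simp
  ring

end Constants


lemma MatIID_eq_diagonal {n : ℕ} (β : Fin (n - 1)) :
    MatIID n β = Matrix.diagonal fun a => stepSeq n β.val
      (2 * LObt n * LOc n (β.val + 2) / LOqt n)
      (-(2 * LObt n * LOc n (β.val + 2)) / (((n : ℝ) - 1 - β.val) * LOqt n)) a.val :=
  rfl

/-- The diagonal of `MatIID n β` has zero sum, so only the difference of the values taken on its
two constant parts matters. -/
lemma frobeniusInner_diagonal_MatIID {n : ℕ} (β : Fin (n - 1)) (g : ℕ → ℝ) {P Q : ℝ}
    (hP : ∀ a, a = 2 * β.val + 2 ∨ a = 2 * β.val + 3 ∨ a = 2 * n + 2 * β.val + 3 ∨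
      a = 2 * n + 2 * β.val + 4 → g a = P)
    (hQ : ∀ a, (2 * β.val + 4 ≤ a ∧ a ≤ 2 * n + 1) ∨ 2 * n + 2 * β.val + 5 ≤ a → g a = Q) :
    frobeniusInner (Matrix.diagonal fun a : Fin (4 * n + 3) => g a.val) (MatIID n β) =
      4 * (2 * LObt n * LOc n (β.val + 2) / LOqt n) * (P - Q) := by
  have hβ := β.isLt
  have hm : (n : ℝ) - 1 - β.val ≠ 0 := by
    have : (β.val : ℝ) + 2 ≤ n := by exact_mod_cast (by omega : β.val + 2 ≤ n)
    linarith
  have hq := LOqt_eq (n := n) (by omega)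
  have hq0 : LOqt n ≠ 0 := by rw [hq]; positivity
  rw [MatIID_eq_diagonal, frobeniusInner_diagonal, sum_mul_stepSeq (by omega) g hP hQ]
  field_simp
  ring

lemma frobeniusInner_MatIID_self {n : ℕ} (β : Fin (n - 1)) :
    frobeniusInner (MatIID n β) (MatIID n β) =
      (4 * (n : ℝ) + 3) * (4 * n + 5) / (4 * ((n : ℝ) + 1) * ((n : ℝ) + 2)) := by
  have hβ := β.isLt
  have hn : (β.val : ℝ) + 2 ≤ n := by exact_mod_cast (by omega : β.val + 2 ≤ n)
  have hm : (n : ℝ) - 1 - β.val ≠ 0 := by linarith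
  have hm' : (n : ℝ) - β.val ≠ 0 := by linarith
  have hn0 : (n : ℝ) ≠ 0 := by
    have : 0 < n := by omega
    positivity
  have hq0 : LOqt n ≠ 0 := by rw [LOqt_eq (by omega)]; positivity
  have key := frobeniusInner_diagonal_MatIID β (stepSeq n β.val
      (2 * LObt n * LOc n (β.val + 2) / LOqt n)
      (-(2 * LObt n * LOc n (β.val + 2)) / (((n : ℝ) - 1 - β.val) * LOqt n)))
      (fun a ha => if_pos ha) (fun a ha => (if_neg (by omega)).trans (if_pos ha))
  rw [← MatIID_eq_diagonal] at key
  rw [key]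
  trans 16 * LObt n ^ 2 * LOc n (β.val + 2) ^ 2 / LOqt n ^ 2 * (1 + 1 / ((n : ℝ) - 1 - β.val))
  · field_simp
    ring
  · rw [LObt_sq, LOc_sq hβ, LOqt_eq (by omega)]
    field_simp
    ring

lemma frobeniusInner_MatIID_of_lt {n : ℕ} {β γ : Fin (n - 1)} (h : β.val < γ.val) :
    frobeniusInner (MatIID n β) (MatIID n γ) = 0 := by
  have hγ := γ.isLt
  have key := frobeniusInner_diagonal_MatIID γ (stepSeq n β.val
      (2 * LObt n * LOc n (β.val + 2) / LOqt n)
      (-(2 * LObt n * LOc n (β.val + 2)) / (((n : ℝ) - 1 - β.val) * LOqt n)))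
      (fun a ha => (if_neg (by omega)).trans (if_pos (by omega)))
      (fun a ha => (if_neg (by omega)).trans (if_pos (by omega)))
  rwa [← MatIID_eq_diagonal, sub_self, mul_zero] at key

lemma frobeniusInner_MatII0_MatIID {n : ℕ} (β : Fin (n - 1)) :
    frobeniusInner (MatII0 n) (MatIID n β) = 0 := by
  have hβ := β.isLt
  have h := frobeniusInner_diagonal_MatIID β
    (fun a => if a = 0 ∨ a = 1 ∨ a = 2 * n + 2 then LObt n / LOat n
      else -(((n : ℝ) + 2) * LOat n * LObt n) / ((n : ℝ) * LOqt n))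
    (fun a ha => if_neg (by omega)) (fun a ha => if_neg (by omega))
  rw [sub_self, mul_zero] at h
  exact h

lemma frobeniusInner_MatII0_self {n : ℕ} (hn : 1 ≤ n) :
    frobeniusInner (MatII0 n) (MatII0 n) =
      (4 * (n : ℝ) + 3) * (4 * n + 5) / (8 * ((n : ℝ) + 1)) := by
  have h : (n : ℝ) ≠ 0 := by positivity
  rw [MatII0, frobeniusInner_diagonal, sum_fin_eq_blocks n fun a =>
    (if a = 0 ∨ a = 1 ∨ a = 2 * n + 2 then LObt n / LOat n
      else -(((n : ℝ) + 2) * LOat n * LObt n) / ((n : ℝ) * LOqt n)) *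
    (if a = 0 ∨ a = 1 ∨ a = 2 * n + 2 then LObt n / LOat n
      else -(((n : ℝ) + 2) * LOat n * LObt n) / ((n : ℝ) * LOqt n))]
  rw [Finset.sum_congr rfl (g := fun _ =>
    4 * (((n : ℝ) + 2) ^ 2 * LOat n ^ 2 * LObt n ^ 2 / ((n : ℝ) ^ 2 * LOqt n ^ 2)))]
  · simp only [true_or, or_true, if_true, Finset.sum_const, Finset.card_range, nsmul_eq_mul]
    trans 3 * (LObt n ^ 2 / LOat n ^ 2) +
      n * (4 * (((n : ℝ) + 2) ^ 2 * LOat n ^ 2 * LObt n ^ 2 / ((n : ℝ) ^ 2 * LOqt n ^ 2)))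
    · ring
    · rw [LOat_sq, LObt_sq, LOqt_eq hn]
      field_simp
      ring
  · intro κ hκ
    have hκ' := Finset.mem_range.mp hκ
    rw [if_neg (by omega), if_neg (by omega), if_neg (by omega), if_neg (by omega)]
    ring

lemma frobeniusInner_Bmat_diagonal_of_ne {n : ℕ} {d d' : Unit ⊕ Fin (n - 1)} (h : d ≠ d') :
    frobeniusInner (Bmat n (Sum.inl d)) (Bmat n (Sum.inl d')) = 0 := by
  rcases d with _ | β <;> rcases d' with _ | γ
  · exact absurd rfl h
  · exact frobeniusInner_MatII0_MatIID γ
  · exact (frobeniusInner_comm _ _).trans (frobeniusInner_MatII0_MatIID β)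
  · have hβγ : β.val ≠ γ.val := fun e => h (congrArg Sum.inr (Fin.ext e))
    rcases lt_or_gt_of_ne hβγ with hlt | hlt
    · exact frobeniusInner_MatIID_of_lt hlt
    · exact (frobeniusInner_comm _ _).trans (frobeniusInner_MatIID_of_lt hlt)

lemma frobeniusInner_diagonal_Bmat_inr {n : ℕ} (d : Fin (4 * n + 3) → ℝ)
    (e : Fin n ⊕ Fin n ⊕ Fin n ⊕ Fin n ⊕
      SpherePairs n ⊕ SpherePairs n ⊕ SpherePairs n ⊕ SpherePairs n) :
    frobeniusInner (Matrix.diagonal d) (Bmat n (Sum.inr e)) = 0 := by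
  rcases e with κ | κ | κ | κ | p | p | p | p
  iterate 4
    have hκ := κ.isLt
    simp only [Bmat, MatII1, MatII2, MatII3, MatII4, frobeniusInner_add_right]
    simp (disch := (dsimp only; omega)) only [frobeniusInner_diagonal_symEntry, add_zero]
  all_goals
    obtain ⟨⟨⟨k, hk⟩, ⟨l, hl⟩⟩, hkl⟩ := p
    have hkl' : k < l := hkl
    simp only [Bmat, MatIIE, MatIIF, MatIIG, MatIIH, frobeniusInner_add_right]
    simp (disch := (dsimp only; omega)) only [frobeniusInner_diagonal_symEntry, add_zero]

lemma SpherePairs.ne_iff {m : ℕ} {p q : SpherePairs m} :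
    p ≠ q ↔ p.1.1.val ≠ q.1.1.val ∨ p.1.2.val ≠ q.1.2.val := by
  rw [ne_eq, Subtype.ext_iff, Prod.ext_iff, Fin.ext_iff, Fin.ext_iff]
  tauto

set_option maxHeartbeats 4000000 in
lemma frobeniusInner_Bmat_inr_of_ne {n : ℕ}
    {e e' : Fin n ⊕ Fin n ⊕ Fin n ⊕ Fin n ⊕
      SpherePairs n ⊕ SpherePairs n ⊕ SpherePairs n ⊕ SpherePairs n} (h : e ≠ e') :
    frobeniusInner (Bmat n (Sum.inr e)) (Bmat n (Sum.inr e')) = 0 := by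
  rcases e with κ | κ | κ | κ | p | p | p | p <;>
    rcases e' with κ' | κ' | κ' | κ' | p' | p' | p' | p' <;>
    simp only [ne_eq, Sum.inl.injEq, Sum.inr.injEq, reduceCtorEq, not_false_eq_true,
      Fin.ext_iff] at h <;>
    (try have hκ := κ.isLt) <;>
    (try have hκ' := κ'.isLt) <;>
    (try have hk := p.1.1.isLt
         have hl := p.1.2.isLt
         have hkl : p.1.1.val < p.1.2.val := p.2) <;>
    (try have hk' := p'.1.1.isLt
         have hl' := p'.1.2.isLt
         have hkl' : p'.1.1.val < p'.1.2.val := p'.2) <;>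
    (try replace h := SpherePairs.ne_iff.mp h) <;>
    simp only [Bmat, MatII1, MatII2, MatII3, MatII4, MatIIE, MatIIF, MatIIG, MatIIH,
      frobeniusInner_add_left, frobeniusInner_add_right] <;>
    simp (disch := (dsimp only; omega)) only [frobeniusInner_symEntry_of_disjoint, add_zero]

lemma frobeniusInner_Bmat_of_ne {n : ℕ} {ν μ : TypeIIIdx n} (h : ν ≠ μ) :
    frobeniusInner (Bmat n ν) (Bmat n μ) = 0 := by
  have mixed : ∀ d e, frobeniusInner (Bmat n (Sum.inl d)) (Bmat n (Sum.inr e)) = 0 := by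
    rintro (_ | β) e <;> exact frobeniusInner_diagonal_Bmat_inr _ e
  rcases ν with d | e <;> rcases μ with d' | e'
  · exact frobeniusInner_Bmat_diagonal_of_ne fun hd => h (congrArg Sum.inl hd)
  · exact mixed d e'
  · exact (frobeniusInner_comm _ _).trans (mixed d' e)
  · exact frobeniusInner_Bmat_inr_of_ne fun he => h (congrArg Sum.inr he)

lemma frobeniusInner_Bmat_inr_self_le {n : ℕ}
    (e : Fin n ⊕ Fin n ⊕ Fin n ⊕ Fin n ⊕
      SpherePairs n ⊕ SpherePairs n ⊕ SpherePairs n ⊕ SpherePairs n) :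
    frobeniusInner (Bmat n (Sum.inr e)) (Bmat n (Sum.inr e)) ≤ 8 * LOvt n ^ 2 := by
  have hv := sq_nonneg (LOvt n)
  rcases e with κ | κ | κ | κ | p | p | p | p
  iterate 4
    have hκ := κ.isLt
    simp only [Bmat, MatII1, MatII2, MatII3, MatII4, frobeniusInner_add_left,
      frobeniusInner_add_right]
    simp (disch := (dsimp only; omega)) only [frobeniusInner_symEntry_self,
      frobeniusInner_symEntry_of_disjoint, neg_sq]
    linarith
  all_goals
    have hk := p.1.1.isLt
    have hl := p.1.2.isLt
    have hkl : p.1.1.val < p.1.2.val := p.2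
    simp only [Bmat, MatIIE, MatIIF, MatIIG, MatIIH, frobeniusInner_add_left,
      frobeniusInner_add_right]
    simp (disch := (dsimp only; omega)) only [frobeniusInner_symEntry_self,
      frobeniusInner_symEntry_of_disjoint, neg_sq]
    linarith

lemma frobeniusInner_Bmat_self_lt {n : ℕ} (hn : 1 ≤ n) {ν : TypeIIIdx n}
    (h : ν ≠ Sum.inl (Sum.inl ())) :
    frobeniusInner (Bmat n ν) (Bmat n ν) <
      (4 * (n : ℝ) + 3) * (4 * n + 5) / (8 * ((n : ℝ) + 1)) := by
  have hn' : (1 : ℝ) ≤ n := by exact_mod_cast hn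
  have hlt : (4 * (n : ℝ) + 3) * (4 * n + 5) / (4 * ((n : ℝ) + 1) * ((n : ℝ) + 2)) <
      (4 * (n : ℝ) + 3) * (4 * n + 5) / (8 * ((n : ℝ) + 1)) :=
    div_lt_div_of_pos_left (by positivity) (by positivity) (by nlinarith)
  rcases ν with (_ | β) | e
  · exact absurd rfl h
  · exact (frobeniusInner_MatIID_self β).trans_lt hlt
  · refine (frobeniusInner_Bmat_inr_self_le e).trans_lt (lt_of_eq_of_lt ?_ hlt)
    rw [LOvt_sq hn]
    field_simp
    ring

lemma frobeniusInner_sum_smul_left {m : ℕ} {ι : Type*} [Fintype ι] (c : ι → ℝ)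
    (B : ι → Matrix (Fin m) (Fin m) ℝ) (N : Matrix (Fin m) (Fin m) ℝ) :
    frobeniusInner (∑ i, c i • B i) N = ∑ i, c i * frobeniusInner (B i) N := by
  simp only [frobeniusInner, Matrix.sum_apply, Matrix.smul_apply, smul_eq_mul,
    Finset.sum_mul, Finset.mul_sum]
  rw [Finset.sum_congr rfl fun a _ => Finset.sum_comm, Finset.sum_comm]
  simp only [mul_assoc]

lemma frobeniusInner_sum_smul_self {m : ℕ} {ι : Type*} [Fintype ι]
    {B : ι → Matrix (Fin m) (Fin m) ℝ}
    (hB : ∀ i j, i ≠ j → frobeniusInner (B i) (B j) = 0) (c : ι → ℝ) :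
    frobeniusInner (∑ i, c i • B i) (∑ i, c i • B i) =
      ∑ i, c i ^ 2 * frobeniusInner (B i) (B i) := by
  rw [frobeniusInner_sum_smul_left]
  refine Finset.sum_congr rfl fun i _ => ?_
  rw [frobeniusInner_comm, frobeniusInner_sum_smul_left, Finset.sum_eq_single i
    (fun j _ hj => by rw [hB j i hj, mul_zero]) (by simp)]
  ring

/-- The maximal squared norm `𝒮²` of the second fundamental
form of the type-II Lawson–Osserman sphere: norms of `B^{4n+4}` and
`B^{8n+3+α}`, the sharp bound `(4n+3)(4n+5)/(8(n+1))` attained exactly at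
`±B^{4n+4}`, and `𝒮² < 2(n+1)`, half the dimension of the cone `CF'`. -/
theorem typeII_S_squared (n : ℕ) (hn : 1 ≤ n) :
    (∑ a, ∑ b, (MatII0 n a b) ^ 2 =
      (4 * (n : ℝ) + 3) * (4 * n + 5) / (8 * ((n : ℝ) + 1))) ∧
    (∀ β : Fin (n - 1), ∑ a, ∑ b, (MatIID n β a b) ^ 2 =
      (4 * (n : ℝ) + 3) * (4 * n + 5) / (4 * ((n : ℝ) + 1) * ((n : ℝ) + 2))) ∧
    (∀ lam : TypeIIIdx n → ℝ, (∑ ν, lam ν ^ 2) = 1 →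
      ((∑ a, ∑ b, ((∑ ν, lam ν • Bmat n ν) a b) ^ 2) ≤
          (4 * (n : ℝ) + 3) * (4 * n + 5) / (8 * ((n : ℝ) + 1)) ∧
        ((∑ a, ∑ b, ((∑ ν, lam ν • Bmat n ν) a b) ^ 2) =
            (4 * (n : ℝ) + 3) * (4 * n + 5) / (8 * ((n : ℝ) + 1)) ↔
          ((lam (Sum.inl (Sum.inl ())) = 1 ∨ lam (Sum.inl (Sum.inl ())) = -1) ∧
            ∀ ν : TypeIIIdx n, ν ≠ Sum.inl (Sum.inl ()) → lam ν = 0)))) ∧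
    (4 * (n : ℝ) + 3) * (4 * n + 5) / (8 * ((n : ℝ) + 1)) < 2 * ((n : ℝ) + 1) := by
  have hself := frobeniusInner_MatII0_self hn
  refine ⟨frobeniusInner_self (MatII0 n) ▸ hself,
    fun β => frobeniusInner_self (MatIID n β) ▸ frobeniusInner_MatIID_self β, ?_, ?_⟩
  · intro lam hlam
    rw [← frobeniusInner_self, frobeniusInner_sum_smul_self
      (fun _ _ h => frobeniusInner_Bmat_of_ne h)]
    set W := (4 * (n : ℝ) + 3) * (4 * n + 5) / (8 * ((n : ℝ) + 1)) with hW
    have hlt : ∀ ν, ν ≠ Sum.inl (Sum.inl ()) → frobeniusInner (Bmat n ν) (Bmat n ν) < W :=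
      fun ν hν => frobeniusInner_Bmat_self_lt hn hν
    have hle : ∀ ν, frobeniusInner (Bmat n ν) (Bmat n ν) ≤ W := fun ν => by
      by_cases hν : ν = Sum.inl (Sum.inl ())
      · exact hν ▸ hself.le
      · exact (hlt ν hν).le
    have hterm : ∀ ν, 0 ≤ lam ν ^ 2 * (W - frobeniusInner (Bmat n ν) (Bmat n ν)) :=
      fun ν => mul_nonneg (sq_nonneg _) (sub_nonneg.mpr (hle ν))
    have hdefect : W - ∑ ν, lam ν ^ 2 * frobeniusInner (Bmat n ν) (Bmat n ν) =
        ∑ ν, lam ν ^ 2 * (W - frobeniusInner (Bmat n ν) (Bmat n ν)) := by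
      simp only [mul_sub, Finset.sum_sub_distrib]
      rw [← Finset.sum_mul, hlam, one_mul]
    refine ⟨sub_nonneg.mp (hdefect ▸ Finset.sum_nonneg fun ν _ => hterm ν), ?_, ?_⟩
    · intro heq
      rw [heq, sub_self, eq_comm, Finset.sum_eq_zero_iff_of_nonneg fun ν _ => hterm ν] at hdefect
      have hzero : ∀ ν : TypeIIIdx n, ν ≠ Sum.inl (Sum.inl ()) → lam ν = 0 := fun ν hν => by
        rcases mul_eq_zero.mp (hdefect ν (Finset.mem_univ ν)) with h | h
        · exact pow_eq_zero_iff two_ne_zero |>.mp h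
        · exact absurd h (sub_pos.mpr (hlt ν hν)).ne'
      refine ⟨sq_eq_one_iff.mp ?_, hzero⟩
      rw [← hlam, Finset.sum_eq_single (Sum.inl (Sum.inl ()))
        (fun ν _ hν => by rw [hzero ν hν, zero_pow two_ne_zero]) (by simp)]
    · rintro ⟨h₁, hzero⟩
      rw [Finset.sum_eq_single (Sum.inl (Sum.inl ()))
        (fun ν _ hν => by rw [hzero ν hν, zero_pow two_ne_zero, zero_mul]) (by simp),
        sq_eq_one_iff.mpr h₁, one_mul]
      exact hself
  · rw [div_lt_iff₀ (by positivity)]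
    nlinarith
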